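/- arXiv:1001.0910 — 3 statements merged into one kernel-verified Lean document; each statement's English description precedes it below -/
import Mathlib

section
/- Let d ≥ 1 be an integer, α ∈ (0,2) with 2−α < d, m > 1 and R > 0. With λ = 1/(d(m−1)+α) and the Barenblatt profile Φ_{α,m}(y) = (k(R²−|y|²)_+^{α/2})^{1/(m−1)}, the function I_{2−α}(Φ_{α,m}^{m−1}) is differentiable at every y ∈ ℝ^d with |y| < R and ∇(I_{2−α}(Φ_{α,m}^{m−1}))(y) = −λ y. -/
open Real MeasureTheory

/-- The Riesz potential `I_β(u)(x)` on `ℝ^d`. -/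
noncomputable def rieszPotential (d : ℕ) (β : ℝ)
    (u : EuclideanSpace ℝ (Fin d) → ℝ) (x : EuclideanSpace ℝ (Fin d)) : ℝ :=
  (Real.Gamma (((d : ℝ) - β) / 2) /
      (2 ^ β * Real.pi ^ ((d : ℝ) / 2) * Real.Gamma (β / 2))) *
    ∫ z : EuclideanSpace ℝ (Fin d), u z * ‖x - z‖ ^ (β - (d : ℝ))

open Set in
theorem lintegral_rpow_mul_exp_neg_mul {a r : ℝ} (ha : 0 < a) (hr : 0 < r) :
    ∫⁻ t in Ioi (0 : ℝ), ENNReal.ofReal (t ^ (a - 1) * exp (-(r * t))) =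
      ENNReal.ofReal (r ^ (-a) * Gamma a) := by
  rw [← ofReal_integral_eq_lintegral_ofReal, integral_rpow_mul_exp_neg_mul_Ioi ha hr,
    one_div, inv_rpow hr.le, rpow_neg hr.le]
  · refine (integrableOn_rpow_mul_exp_neg_mul_rpow (p := 1) (s := a - 1) (by linarith) one_pos
      hr).congr_fun (fun t _ => by simp) measurableSet_Ioi
  · filter_upwards [ae_restrict_mem measurableSet_Ioi] with t ht
    have : 0 < t := ht
    positivity

open Set in
/-- The Euler beta integral over the half-line. -/
theorem lintegral_rpow_mul_one_add_rpow {a b : ℝ} (ha : 0 < a) (hb : 0 < b) :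
    ∫⁻ t in Ioi (0 : ℝ), ENNReal.ofReal (t ^ (a - 1) * (1 + t) ^ (-(a + b))) =
      ENNReal.ofReal (Gamma a * Gamma b / Gamma (a + b)) := by
  have hab : 0 < a + b := by positivity
  have hG := Gamma_pos_of_pos hab
  have hGa := Gamma_pos_of_pos ha
  have hpt : ∀ t ∈ Ioi (0 : ℝ), ENNReal.ofReal (t ^ (a - 1) * (1 + t) ^ (-(a + b))) =
      ∫⁻ u in Ioi (0 : ℝ), ENNReal.ofReal
        (t ^ (a - 1) * (Gamma (a + b))⁻¹ * (u ^ (a + b - 1) * exp (-((1 + t) * u)))) := by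
    intro t ht
    have ht : 0 < t := ht
    have h0 : 0 ≤ t ^ (a - 1) * (Gamma (a + b))⁻¹ := by positivity
    simp_rw [ENNReal.ofReal_mul h0]
    rw [lintegral_const_mul' _ _ ENNReal.ofReal_ne_top,
      lintegral_rpow_mul_exp_neg_mul hab (by positivity), ← ENNReal.ofReal_mul h0]
    congr 1
    field_simp
  rw [setLIntegral_congr_fun measurableSet_Ioi hpt, lintegral_lintegral_swap (by fun_prop)]
  have hpt' : ∀ u ∈ Ioi (0 : ℝ), ∫⁻ t in Ioi (0 : ℝ), ENNReal.ofReal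
        (t ^ (a - 1) * (Gamma (a + b))⁻¹ * (u ^ (a + b - 1) * exp (-((1 + t) * u)))) =
      ENNReal.ofReal (Gamma a * (Gamma (a + b))⁻¹) *
        ENNReal.ofReal (u ^ (b - 1) * exp (-(1 * u))) := by
    intro u hu
    have hu : 0 < u := hu
    have h0 : 0 ≤ (Gamma (a + b))⁻¹ * (u ^ (a + b - 1) * exp (-u)) := by positivity
    have (t : ℝ) : t ^ (a - 1) * (Gamma (a + b))⁻¹ * (u ^ (a + b - 1) * exp (-((1 + t) * u))) =
        (Gamma (a + b))⁻¹ * (u ^ (a + b - 1) * exp (-u)) * (t ^ (a - 1) * exp (-(u * t))) := by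
      rw [show -((1 + t) * u) = -u + -(u * t) by ring, exp_add]
      ring
    simp_rw [this, ENNReal.ofReal_mul h0]
    rw [lintegral_const_mul' _ _ ENNReal.ofReal_ne_top, lintegral_rpow_mul_exp_neg_mul ha hu,
      ← ENNReal.ofReal_mul h0, ← ENNReal.ofReal_mul (by positivity)]
    congr 1
    rw [show a + b - 1 = a + (b - 1) by ring, rpow_add hu, rpow_neg hu.le, one_mul]
    field_simp
  rw [setLIntegral_congr_fun measurableSet_Ioi hpt',
    lintegral_const_mul' _ _ ENNReal.ofReal_ne_top, lintegral_rpow_mul_exp_neg_mul hb one_pos,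
    ← ENNReal.ofReal_mul (by positivity), one_rpow, one_mul]
  congr 1
  ring

open Set Metric Module in
/-- Polar coordinates for lower Lebesgue integrals. -/
theorem lintegral_eq_lintegral_toSphere {E : Type*} [NormedAddCommGroup E] [NormedSpace ℝ E]
    [MeasurableSpace E] [BorelSpace E] [FiniteDimensional ℝ E] [Nontrivial E]
    (μ : Measure E) [μ.IsAddHaarMeasure] {f : E → ENNReal} (hf : Measurable f) :
    ∫⁻ x, f x ∂μ = ∫⁻ θ, ∫⁻ r in Ioi (0 : ℝ),
      ENNReal.ofReal (r ^ (finrank ℝ E - 1)) * f (r • (θ : E)) ∂volume ∂μ.toSphere := by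
  have hmeas : Measurable fun p : sphere (0 : E) 1 × Ioi (0 : ℝ) => f (p.2.1 • p.1.1) := by
    fun_prop
  calc
    ∫⁻ x, f x ∂μ = ∫⁻ x : ({(0)}ᶜ : Set E), f x.1 ∂(μ.comap (↑)) := by
      rw [lintegral_subtype_comap (measurableSet_singleton _).compl, restrict_compl_singleton]
    _ = ∫⁻ p, f (p.2.1 • p.1.1) ∂(μ.toSphere.prod (.volumeIoiPow (finrank ℝ E - 1))) := by
      rw [← μ.measurePreserving_homeomorphUnitSphereProd.lintegral_comp hmeas]
      refine lintegral_congr fun x => ?_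
      congr 1
      have h := congrArg Subtype.val ((homeomorphUnitSphereProd E).symm_apply_apply x)
      rw [← homeomorphUnitSphereProd_symm_apply_coe, h]
    _ = _ := by
      rw [lintegral_prod _ hmeas.aemeasurable]
      refine lintegral_congr fun θ => ?_
      rw [Measure.volumeIoiPow, lintegral_withDensity_eq_lintegral_mul _ (by fun_prop)
        (by fun_prop)]
      exact lintegral_subtype_comap measurableSet_Ioi fun r : ℝ =>
        ENNReal.ofReal (r ^ (finrank ℝ E - 1)) * f (r • (θ : E))

section InnerProductSpace

variable {E : Type*} [NormedAddCommGroup E] [InnerProductSpace ℝ E] [MeasurableSpace E]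
  [BorelSpace E] [FiniteDimensional ℝ E]

open Set Metric Module Pointwise in
/-- The law of `⟪c, θ⟫` under the surface measure of the unit sphere depends only on `‖c‖`. -/
theorem map_inner_toSphere_eq_of_norm_eq {c c' : E} (h : ‖c‖ = ‖c'‖) :
    (Measure.toSphere (volume : Measure E)).map (fun θ : sphere (0 : E) 1 => inner ℝ c (θ : E)) =
      (Measure.toSphere (volume : Measure E)).map (fun θ : sphere (0 : E) 1 => inner ℝ c' (θ : E)) := by
  let g : E ≃ₗᵢ[ℝ] E := Submodule.reflection (ℝ ∙ (c' - c))ᗮ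
  have hgc : g c' = c := Submodule.reflection_sub h.symm
  ext A hA
  have hm (b : E) : Measurable fun θ : sphere (0 : E) 1 => inner ℝ b (θ : E) := by fun_prop
  rw [Measure.map_apply (hm c) hA, Measure.map_apply (hm c') hA,
    Measure.toSphere_apply' _ (hm c hA), Measure.toSphere_apply' _ (hm c' hA)]
  congr 1
  rw [← g.measurePreserving.measure_preimage_emb g.toHomeomorph.measurableEmbedding]
  congr 1
  ext w
  simp only [mem_smul, mem_image, mem_preimage, Subtype.exists, mem_sphere_zero_iff_norm,
    exists_and_left, exists_prop]
  constructor
  · rintro ⟨r, hr, _, ⟨θ, hθ, hn, rfl⟩, hw⟩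
    refine ⟨r, hr, g.symm θ, ⟨g.symm θ, ?_, by simpa using hn, rfl⟩, ?_⟩
    · rwa [← g.inner_map_map, hgc, g.apply_symm_apply]
    · rw [← map_smul, hw, g.symm_apply_apply]
  · rintro ⟨r, hr, _, ⟨θ, hθ, hn, rfl⟩, rfl⟩
    exact ⟨r, hr, g θ, ⟨g θ, by rwa [← hgc, g.inner_map_map], by simpa using hn, rfl⟩, by simp⟩

theorem integral_inner_toSphere_eq_of_norm_eq {c c' : E} (h : ‖c‖ = ‖c'‖) {F : ℝ → ℝ}
    (hF : Continuous F) :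
    ∫ θ, F (inner ℝ c (θ : E)) ∂Measure.toSphere (volume : Measure E) =
      ∫ θ, F (inner ℝ c' (θ : E)) ∂Measure.toSphere (volume : Measure E) := by
  have hm (b : E) : AEMeasurable (fun θ : Metric.sphere (0 : E) 1 => inner ℝ b (θ : E))
    (Measure.toSphere (volume : Measure E)) := by fun_prop
  rw [← integral_map (hm c) hF.aestronglyMeasurable, map_inner_toSphere_eq_of_norm_eq h,
    integral_map (hm c') hF.aestronglyMeasurable]

theorem integrable_inner_toSphere (c : E) {F : ℝ → ℝ} (hF : Continuous F) :
    Integrable (fun θ : Metric.sphere (0 : E) 1 => F (inner ℝ c (θ : E))) (Measure.toSphere (volume : Measure E)) := by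
  apply Continuous.integrable_of_hasCompactSupport
  · fun_prop
  · exact HasCompactSupport.of_compactSpace _

open Module in
theorem integral_inner_sq_toSphere [Nontrivial E] (c : E) :
    ∫ θ, inner ℝ c (θ : E) ^ 2 ∂Measure.toSphere (volume : Measure E) =
      (Measure.toSphere (volume : Measure E)).real Set.univ * (‖c‖ ^ 2 / finrank ℝ E) := by
  have hd : (finrank ℝ E : ℝ) ≠ 0 := by exact_mod_cast finrank_pos.ne'
  have key : ∑ i : Fin (finrank ℝ E), ∫ θ, inner ℝ (‖c‖ • stdOrthonormalBasis ℝ E i) (θ : E) ^ 2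
      ∂Measure.toSphere (volume : Measure E) = (Measure.toSphere (volume : Measure E)).real Set.univ * ‖c‖ ^ 2 := by
    rw [← integral_finsetSum _ fun i _ => integrable_inner_toSphere _ (continuous_pow 2)]
    have (θ : Metric.sphere (0 : E) 1) :
        ∑ i, inner ℝ (‖c‖ • stdOrthonormalBasis ℝ E i) (θ : E) ^ 2 = ‖c‖ ^ 2 := by
      simp only [real_inner_smul_left, mul_pow, ← Finset.mul_sum]
      rw [(stdOrthonormalBasis ℝ E).sum_sq_inner_right]
      simp
    simp [this]
  have hc (i : Fin (finrank ℝ E)) :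
      ∫ θ, inner ℝ (‖c‖ • stdOrthonormalBasis ℝ E i) (θ : E) ^ 2
        ∂Measure.toSphere (volume : Measure E) = ∫ θ, inner ℝ c (θ : E) ^ 2
        ∂Measure.toSphere (volume : Measure E) :=
    integral_inner_toSphere_eq_of_norm_eq (by simp [norm_smul]) (continuous_pow 2)
  simp only [hc, Finset.sum_const, Finset.card_univ, Fintype.card_fin, nsmul_eq_mul] at key
  field_simp
  linarith

/-- The mean over the unit sphere of half the square of the distance from the origin to the
boundary of a ball containing it. -/
theorem integral_sq_root_toSphere [Nontrivial E] (c : E) {δ : ℝ} (hδ : 0 < δ) :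
    ∫ θ, (inner ℝ c (θ : E) + √(inner ℝ c (θ : E) ^ 2 + δ)) ^ 2 / 2
        ∂Measure.toSphere (volume : Measure E) =
      (Measure.toSphere (volume : Measure E)).real Set.univ *
        (‖c‖ ^ 2 / Module.finrank ℝ E + δ / 2) := by
  have hodd : ∫ θ, inner ℝ c (θ : E) * √(inner ℝ c (θ : E) ^ 2 + δ)
      ∂Measure.toSphere (volume : Measure E) = 0 := by
    have := integral_inner_toSphere_eq_of_norm_eq (c := c) (c' := -c) (by simp)
      (F := fun b => b * √(b ^ 2 + δ)) (by fun_prop)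
    simp only [inner_neg_left, neg_sq, neg_mul, integral_neg] at this
    linarith
  have hsplit (θ : Metric.sphere (0 : E) 1) :
      (inner ℝ c (θ : E) + √(inner ℝ c (θ : E) ^ 2 + δ)) ^ 2 / 2 =
        inner ℝ c (θ : E) ^ 2 + (δ / 2 +
          inner ℝ c (θ : E) * √(inner ℝ c (θ : E) ^ 2 + δ)) := by
    have := Real.sq_sqrt (show 0 ≤ inner ℝ c (θ : E) ^ 2 + δ by positivity)
    linear_combination this / 2
  have hint := integrable_inner_toSphere c (F := fun b => b * √(b ^ 2 + δ)) (by fun_prop)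
  simp only [hsplit]
  rw [integral_add (integrable_inner_toSphere c (continuous_pow 2))
    (by exact (integrable_const _).add hint), integral_add (integrable_const _) hint, hodd,
    integral_inner_sq_toSphere]
  simp
  ring

open Set Module in
/-- The Newtonian potential at the origin of the ball with centre `c` and squared radius
`‖c‖ ^ 2 + δ`. -/
theorem setLIntegral_norm_rpow_two_sub_finrank [Nontrivial E] (c : E) {δ : ℝ} (hδ : 0 < δ) :
    ∫⁻ w in {w : E | ‖w‖ ^ 2 - 2 * inner ℝ c w < δ},
        ENNReal.ofReal (‖w‖ ^ (2 - finrank ℝ E : ℝ)) =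
      ENNReal.ofReal ((Measure.toSphere (volume : Measure E)).real univ *
        (‖c‖ ^ 2 / finrank ℝ E + δ / 2)) := by
  have hS : MeasurableSet {w : E | ‖w‖ ^ 2 - 2 * inner ℝ c w < δ} :=
    measurableSet_lt (by fun_prop) (by fun_prop)
  rw [← lintegral_indicator hS, lintegral_eq_lintegral_toSphere volume
    ((by fun_prop : Measurable fun w : E =>
      ENNReal.ofReal (‖w‖ ^ (2 - finrank ℝ E : ℝ))).indicator hS),
    ← integral_sq_root_toSphere c hδ, ofReal_integral_eq_lintegral_ofReal]
  · refine lintegral_congr fun θ => ?_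
    set b : ℝ := inner ℝ c (θ : E) with hb
    set T : ℝ := b + √(b ^ 2 + δ) with hT
    have hsq := Real.sq_sqrt (show 0 ≤ b ^ 2 + δ by positivity)
    have hlt : |b| < √(b ^ 2 + δ) := by
      rw [← Real.sqrt_sq_eq_abs]
      exact Real.sqrt_lt_sqrt (sq_nonneg b) (by linarith)
    obtain ⟨hlt₁, hlt₂⟩ := abs_lt.1 hlt
    have hTpos : 0 < T := by linarith
    have hθ : ‖(θ : E)‖ = 1 := by simp
    have hpt : ∀ r ∈ Ioi (0 : ℝ), ENNReal.ofReal (r ^ (finrank ℝ E - 1)) *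
        indicator {w : E | ‖w‖ ^ 2 - 2 * inner ℝ c w < δ}
          (fun w => ENNReal.ofReal (‖w‖ ^ (2 - finrank ℝ E : ℝ))) (r • (θ : E)) =
        indicator (Iio T) (fun r => ENNReal.ofReal r) r := by
      intro r hr
      have hr : 0 < r := hr
      have hiff : r • (θ : E) ∈ {w : E | ‖w‖ ^ 2 - 2 * inner ℝ c w < δ} ↔ r ∈ Iio T := by
        simp only [mem_ofPred_eq, norm_smul, hθ, mul_one, Real.norm_eq_abs, sq_abs,
          real_inner_smul_right, ← hb, mem_Iio]
        have hfac : r ^ 2 - 2 * (r * b) - δ = (r - T) * (r + (√(b ^ 2 + δ) - b)) := by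
          rw [hT]; linear_combination hsq
        have hp : 0 < r + (√(b ^ 2 + δ) - b) := by linarith
        rw [← sub_neg, hfac, ← sub_neg (a := r)]
        exact ⟨fun h => by nlinarith, fun h => mul_neg_of_neg_of_pos h hp⟩
      by_cases h : r ∈ Iio T
      · rw [indicator_of_mem h, indicator_of_mem (hiff.2 h), ← ENNReal.ofReal_mul (by positivity)]
        congr 1
        have hn : 1 ≤ finrank ℝ E := finrank_pos
        rw [norm_smul, hθ, mul_one, Real.norm_of_nonneg hr.le, ← Real.rpow_natCast,
          ← Real.rpow_add hr, Nat.cast_sub hn]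
        norm_num
      · rw [indicator_of_notMem h, indicator_of_notMem (fun h' => h (hiff.1 h')), mul_zero]
    rw [setLIntegral_congr_fun measurableSet_Ioi hpt, lintegral_indicator measurableSet_Iio,
      Measure.restrict_restrict measurableSet_Iio, Iio_inter_Ioi,
      ← ofReal_integral_eq_lintegral_ofReal, ← integral_Ioc_eq_integral_Ioo,
      ← intervalIntegral.integral_of_le hTpos.le]
    · simp
    · exact (intervalIntegral.intervalIntegrable_id (μ := volume) (a := 0) (b := T)).1.mono_set
        Ioo_subset_Ioc_self
    · filter_upwards [ae_restrict_mem measurableSet_Ioo] with r hr using hr.1.le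
  · exact integrable_inner_toSphere c (F := fun b => (b + √(b ^ 2 + δ)) ^ 2 / 2) (by fun_prop)
  · exact .of_forall fun θ => by positivity

open Set Module in
/-- The truncated parabola `(R² - ‖z‖²)₊ ^ s` has a quadratic Riesz potential of order `2 - 2s`
inside the ball of radius `R`. -/
theorem lintegral_max_sq_sub_norm_sq_rpow_mul_norm_sub_rpow [Nontrivial E] {s R : ℝ}
    (hs₀ : 0 < s) (hs₁ : s < 1) {x : E} (hx : ‖x‖ < R) :
    ∫⁻ z, ENNReal.ofReal
        ((max (R ^ 2 - ‖z‖ ^ 2) 0) ^ s * ‖x - z‖ ^ (2 - 2 * s - finrank ℝ E : ℝ)) =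
      ENNReal.ofReal ((Measure.toSphere (volume : Measure E)).real univ *
        (Gamma (1 + s) * Gamma (1 - s)) *
          ((R ^ 2 - ‖x‖ ^ 2) / 2 + (1 - s) / finrank ℝ E * ‖x‖ ^ 2)) := by
  set n : ℝ := (finrank ℝ E : ℝ) with hn
  have hn0 : 0 < n := by rw [hn]; exact_mod_cast finrank_pos
  set σ : ℝ := (Measure.toSphere (volume : Measure E)).real univ
  have hσ : 0 ≤ σ := measureReal_nonneg
  have hρ : 0 < R ^ 2 - ‖x‖ ^ 2 := by nlinarith [norm_nonneg x]
  set ρ : ℝ := R ^ 2 - ‖x‖ ^ 2 with hρdef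
  set q : E → ℝ := fun w => max (R ^ 2 - ‖x - w‖ ^ 2) 0 / ‖w‖ ^ 2 with hq
  have hqm : Measurable q := by fun_prop
  have hq0 : ∀ w, 0 ≤ q w := fun w => by positivity
  have hwm : Measurable fun w : E => ENNReal.ofReal (‖w‖ ^ (2 - n)) := by fun_prop
  have hne : ∀ᵐ w : E, w ≠ 0 := by simp [ae_iff]
  set ν : Measure E := volume.withDensity fun w => ENNReal.ofReal (‖w‖ ^ (2 - n)) with hν
  have hsub : ∫⁻ z, ENNReal.ofReal
        ((max (R ^ 2 - ‖z‖ ^ 2) 0) ^ s * ‖x - z‖ ^ (2 - 2 * s - n)) =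
      ∫⁻ w, ENNReal.ofReal (q w ^ s) ∂ν := by
    rw [← lintegral_sub_left_eq_self _ x, hν,
      lintegral_withDensity_eq_lintegral_mul _ hwm (by fun_prop)]
    refine lintegral_congr_ae ?_
    filter_upwards [hne] with w hw
    have hw : 0 < ‖w‖ := norm_pos_iff.2 hw
    simp only [Pi.mul_apply, sub_sub_cancel]
    rw [← ENNReal.ofReal_mul (by positivity)]
    congr 1
    rw [hq, div_rpow (by positivity) (by positivity), ← rpow_natCast ‖w‖, ← rpow_mul hw.le,
      show (2 - 2 * s - n : ℝ) = (2 - n) - (2 : ℕ) * s by push_cast; ring, rpow_sub hw]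
    ring
  have hlevel : ∀ t ∈ Ioi (0 : ℝ), ν {w | t < q w} * ENNReal.ofReal (t ^ (s - 1)) =
      ENNReal.ofReal (σ * ‖x‖ ^ 2 / n) *
          ENNReal.ofReal (t ^ (s - 1) * (1 + t) ^ (-(s + (2 - s)))) +
        ENNReal.ofReal (σ * ρ / 2) *
          ENNReal.ofReal (t ^ (s - 1) * (1 + t) ^ (-(s + (1 - s)))) := by
    intro t ht
    have ht : 0 < t := ht
    have ht1 : 0 < 1 + t := by linarith
    have hset : ({w | t < q w} : Set E) =ᵐ[volume]
        {w | ‖w‖ ^ 2 - 2 * inner ℝ ((1 + t)⁻¹ • x) w < ρ / (1 + t)} := by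
      filter_upwards [hne] with w hw
      have hw : 0 < ‖w‖ ^ 2 := pow_pos (norm_pos_iff.2 hw) 2
      have hnorm := norm_sub_sq_real x w
      refine propext ?_
      change t < max (R ^ 2 - ‖x - w‖ ^ 2) 0 / ‖w‖ ^ 2 ↔
        ‖w‖ ^ 2 - 2 * inner ℝ ((1 + t)⁻¹ • x) w < ρ / (1 + t)
      have hpos : 0 < t * ‖w‖ ^ 2 := by positivity
      rw [lt_div_iff₀ hw, lt_max_iff, or_iff_left hpos.not_gt, hnorm, real_inner_smul_left,
        lt_div_iff₀ ht1]
      have : (‖w‖ ^ 2 - 2 * ((1 + t)⁻¹ * inner ℝ x w)) * (1 + t) =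
          (1 + t) * ‖w‖ ^ 2 - 2 * inner ℝ x w := by field_simp
      rw [this, hρdef]
      constructor <;> intro h <;> linarith
    have hν_set : ν {w | t < q w} =
        ENNReal.ofReal (σ * (‖(1 + t)⁻¹ • x‖ ^ 2 / n + ρ / (1 + t) / 2)) := by
      rw [hν, withDensity_apply _ (measurableSet_lt measurable_const hqm),
        setLIntegral_congr hset, setLIntegral_norm_rpow_two_sub_finrank _ (by positivity)]
    rw [hν_set, ← ENNReal.ofReal_mul (by positivity), ← ENNReal.ofReal_mul (by positivity),
      ← ENNReal.ofReal_mul (by positivity), ← ENNReal.ofReal_add (by positivity) (by positivity)]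
    congr 1
    rw [show -(s + (2 - s)) = -((2 : ℕ) : ℝ) by push_cast; ring, rpow_neg ht1.le, rpow_natCast,
      show -(s + (1 - s)) = -1 by ring, rpow_neg_one, norm_smul, mul_pow, norm_inv,
      Real.norm_of_nonneg ht1.le]
    field_simp
  rw [hsub, lintegral_rpow_eq_lintegral_meas_lt_mul ν (.of_forall hq0) hqm.aemeasurable hs₀,
    setLIntegral_congr_fun measurableSet_Ioi hlevel, lintegral_add_left (by fun_prop),
    lintegral_const_mul' _ _ ENNReal.ofReal_ne_top, lintegral_const_mul' _ _ ENNReal.ofReal_ne_top,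
    lintegral_rpow_mul_one_add_rpow hs₀ (by linarith),
    lintegral_rpow_mul_one_add_rpow hs₀ (by linarith)]
  have hG1 : Gamma (1 + s) = s * Gamma s := by rw [add_comm, Gamma_add_one hs₀.ne']
  have hG2 : Gamma (2 - s) = (1 - s) * Gamma (1 - s) := by
    rw [← Gamma_add_one (by linarith)]; congr 1; ring
  have hGs := Gamma_pos_of_pos hs₀
  have hG1s : 0 < Gamma (1 - s) := Gamma_pos_of_pos (by linarith)
  have h1s : 0 < 1 - s := by linarith
  rw [show s + (2 - s) = 2 by ring, show s + (1 - s) = 1 by ring, Gamma_two, Gamma_one, hG2, hG1,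
    ← ENNReal.ofReal_mul (by positivity), ← ENNReal.ofReal_mul (by positivity),
    ← ENNReal.ofReal_add (by positivity) (by positivity), ← ENNReal.ofReal_mul hs₀.le]
  congr 1
  field_simp
  ring

open Module in
theorem integral_max_sq_sub_norm_sq_rpow_mul_norm_sub_rpow [Nontrivial E] {s R : ℝ}
    (hs₀ : 0 < s) (hs₁ : s < 1) {x : E} (hx : ‖x‖ < R) :
    ∫ z, (max (R ^ 2 - ‖z‖ ^ 2) 0) ^ s * ‖x - z‖ ^ (2 - 2 * s - finrank ℝ E : ℝ) =
      (Measure.toSphere (volume : Measure E)).real Set.univ *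
        (Gamma (1 + s) * Gamma (1 - s)) *
          ((R ^ 2 - ‖x‖ ^ 2) / 2 + (1 - s) / finrank ℝ E * ‖x‖ ^ 2) := by
  have h1 : 0 < Gamma (1 + s) := Gamma_pos_of_pos (by linarith)
  have h2 : 0 < Gamma (1 - s) := Gamma_pos_of_pos (by linarith)
  have h3 : 0 < R ^ 2 - ‖x‖ ^ 2 := by nlinarith [norm_nonneg x]
  have h4 : 0 < 1 - s := by linarith
  rw [integral_eq_lintegral_of_nonneg_ae (.of_forall fun z => by positivity)
    (by fun_prop : Measurable _).aestronglyMeasurable,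
    lintegral_max_sq_sub_norm_sq_rpow_mul_norm_sub_rpow hs₀ hs₁ hx,
    ENNReal.toReal_ofReal (by positivity)]

end InnerProductSpace

theorem toSphere_real_univ_euclideanSpace {d : ℕ} (hd : 1 ≤ d) :
    (Measure.toSphere (volume : Measure (EuclideanSpace ℝ (Fin d)))).real Set.univ =
      2 * π ^ ((d : ℝ) / 2) / Gamma ((d : ℝ) / 2) := by
  have : Nonempty (Fin d) := ⟨⟨0, hd⟩⟩
  have hd0 : (0 : ℝ) < d := by exact_mod_cast hd
  have hG := Gamma_pos_of_pos (half_pos hd0)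
  rw [Measure.toSphere_real_apply_univ, measureReal_def, EuclideanSpace.volume_ball,
    Fintype.card_fin, Gamma_add_one (half_pos hd0).ne', finrank_euclideanSpace_fin,
    sqrt_eq_rpow, ← rpow_natCast, ← rpow_mul pi_pos.le, ENNReal.ofReal_one, one_pow, one_mul,
    ENNReal.toReal_ofReal (by positivity), one_div_mul_eq_div]
  field_simp

theorem gradient_riesz_potential_barenblatt_profile
    (d : ℕ) (hd : 1 ≤ d) (α m R : ℝ) (hα : α ∈ Set.Ioo (0 : ℝ) 2)
    (hαd : 2 - α < d) (hm : 1 < m) (hR : 0 < R)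
    (lam K k : ℝ)
    (hlam : lam = 1 / ((d : ℝ) * (m - 1) + α))
    (hK : K = Real.Gamma ((d : ℝ) / 2) /
        (2 ^ α * Real.Gamma (1 + α / 2) * Real.Gamma (((d : ℝ) + α) / 2)))
    (hk : k = (d : ℝ) * lam * K)
    (Φ : EuclideanSpace ℝ (Fin d) → ℝ)
    (hΦ : Φ = fun y => (k * (max (R ^ 2 - ‖y‖ ^ 2) 0) ^ (α / 2)) ^ (1 / (m - 1)))
    (y : EuclideanSpace ℝ (Fin d)) (hy : ‖y‖ < R) :
    HasGradientAt
      (rieszPotential d (2 - α) (fun z => Φ z ^ (m - 1)))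
      ((-lam) • y) y := by
  obtain ⟨hα₀, hα₂⟩ := hα
  have : Nonempty (Fin d) := ⟨⟨0, hd⟩⟩
  have hd0 : (0 : ℝ) < d := by exact_mod_cast hd
  have hm1 : 0 < m - 1 := by linarith
  have hGd := Gamma_pos_of_pos (half_pos hd0)
  have hG1 : 0 < Gamma (1 + α / 2) := Gamma_pos_of_pos (by linarith)
  have hG2 : 0 < Gamma (1 - α / 2) := Gamma_pos_of_pos (by linarith)
  have hG3 : 0 < Gamma ((d + α) / 2) := Gamma_pos_of_pos (by linarith)
  have hlam0 : 0 < lam := by rw [hlam]; positivity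
  have hK0 : 0 < K := by rw [hK]; positivity
  have hk0 : 0 < k := by rw [hk]; positivity
  have hpow (z : EuclideanSpace ℝ (Fin d)) :
      Φ z ^ (m - 1) = k * (max (R ^ 2 - ‖z‖ ^ 2) 0) ^ (α / 2) := by
    rw [hΦ, ← rpow_mul (by positivity), one_div_mul_cancel hm1.ne', rpow_one]
  set C : ℝ := Gamma ((d - (2 - α)) / 2) / (2 ^ (2 - α) * π ^ ((d : ℝ) / 2) *
    Gamma ((2 - α) / 2)) * (k * (2 * π ^ ((d : ℝ) / 2) / Gamma ((d : ℝ) / 2) *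
      (Gamma (1 + α / 2) * Gamma (1 - α / 2)))) with hC
  have hpot : ∀ x : EuclideanSpace ℝ (Fin d), ‖x‖ < R →
      rieszPotential d (2 - α) (fun z => Φ z ^ (m - 1)) x =
        C * ((R ^ 2 - ‖x‖ ^ 2) / 2 + (1 - α / 2) / d * ‖x‖ ^ 2) := by
    intro x hx
    have h := integral_max_sq_sub_norm_sq_rpow_mul_norm_sub_rpow (half_pos hα₀)
      (by linarith : α / 2 < 1) hx
    rw [toSphere_real_univ_euclideanSpace hd, finrank_euclideanSpace_fin,
      mul_div_cancel₀ α two_ne_zero] at h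
    simp only [rieszPotential, hpow, mul_assoc k, integral_const_mul, h, hC]
    ring
  have hGrec : Gamma ((d + α) / 2) = (d - (2 - α)) / 2 * Gamma ((d - (2 - α)) / 2) := by
    rw [← Gamma_add_one (by linarith)]; congr 1; ring
  have hCval : C * ((1 - α / 2) / d - 1 / 2) = -lam / 2 := by
    have h2 : (2 : ℝ) ^ (2 - α) = 4 / 2 ^ α := by
      rw [rpow_sub two_pos]; norm_num
    have hG4 : 0 < Gamma ((d - (2 - α)) / 2) := Gamma_pos_of_pos (by linarith)
    have hdα : 0 < d - (2 - α) := by linarith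
    rw [hC, hk, hK, hGrec, h2, show (2 - α) / 2 = 1 - α / 2 by ring]
    field_simp
    ring
  have hgrad : HasGradientAt
      (fun x : EuclideanSpace ℝ (Fin d) => C * (R ^ 2 / 2) + (-lam / 2) * ‖x‖ ^ 2)
      ((-lam) • y) y := by
    rw [hasGradientAt_iff_hasFDerivAt]
    refine (((hasStrictFDerivAt_norm_sq y).hasFDerivAt.const_mul (-lam / 2)).const_add
      (C * (R ^ 2 / 2))).congr_fderiv ?_
    ext v
    simp
    ring
  refine hgrad.congr_of_eventuallyEq ?_
  filter_upwards [(isOpen_lt continuous_norm continuous_const).mem_nhds hy] with x hx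
  rw [hpot x hx, ← hCval]
  ring
end

section
/- Let d ≥ 1 be an integer, α ∈ (0,2) with 2−α < d, m > 1 and R > 0. With λ = 1/(d(m−1)+α) and the Barenblatt profile Φ_{α,m}(y) = (k(R²−|y|²)_+^{α/2})^{1/(m−1)}, for every y ∈ ℝ^d with |y| ≠ R the identity Φ_{α,m}(y) · ∇(I_{2−α}(Φ_{α,m}^{m−1}))(y) = −λ y Φ_{α,m}(y) holds (both sides being the zero vector when |y| > R, since Φ_{α,m} vanishes there); in particular Φ_{α,m} satisfies the profile equation −λ ∇·(y Φ_{α,m}) = ∇·(Φ_{α,m} ∇ I_{2−α}(Φ_{α,m}^{m−1})) in the sense of distributions on ℝ^d. -/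
open Real MeasureTheory

open Set Metric

/-- Integration in polar coordinates, for nonnegative functions. -/
theorem lintegral_polar {E : Type*} [NormedAddCommGroup E] [NormedSpace ℝ E]
    [FiniteDimensional ℝ E] [Nontrivial E] [MeasurableSpace E] [BorelSpace E]
    (μ : Measure E) [μ.IsAddHaarMeasure] {f : E → ENNReal} (hf : Measurable f) :
    ∫⁻ z, f z ∂μ = ∫⁻ θ, ∫⁻ r in Ioi (0 : ℝ),
      ENNReal.ofReal (r ^ (Module.finrank ℝ E - 1)) * f (r • (θ : E)) ∂volume ∂μ.toSphere := by
  have hG : Measurable fun p : sphere (0 : E) 1 × Ioi (0 : ℝ) => f ((p.2 : ℝ) • (p.1 : E)) :=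
    hf.comp (by fun_prop)
  calc ∫⁻ z, f z ∂μ = ∫⁻ z : ({0}ᶜ : Set E), f z ∂(μ.comap (↑)) := by
        rw [lintegral_subtype_comap (measurableSet_singleton _).compl, restrict_compl_singleton]
    _ = ∫⁻ z : ({0}ᶜ : Set E), f (((homeomorphUnitSphereProd E z).2 : ℝ) •
          ((homeomorphUnitSphereProd E z).1 : E)) ∂(μ.comap (↑)) := by
        refine lintegral_congr fun z => ?_
        rw [← homeomorphUnitSphereProd_symm_apply_coe, Homeomorph.symm_apply_apply]
    _ = ∫⁻ p, f ((p.2 : ℝ) • (p.1 : E))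
          ∂(μ.toSphere.prod (.volumeIoiPow (Module.finrank ℝ E - 1))) :=
        μ.measurePreserving_homeomorphUnitSphereProd.lintegral_comp hG
    _ = ∫⁻ θ, ∫⁻ r : Ioi (0 : ℝ), f ((r : ℝ) • (θ : E))
          ∂(.volumeIoiPow (Module.finrank ℝ E - 1)) ∂μ.toSphere :=
        lintegral_prod _ hG.aemeasurable
    _ = _ := by
        refine lintegral_congr fun θ => ?_
        have hg : Measurable fun r : Ioi (0 : ℝ) => f ((r : ℝ) • (θ : E)) := hf.comp (by fun_prop)
        rw [Measure.volumeIoiPow, lintegral_withDensity_eq_lintegral_mul _ (by fun_prop) hg]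
        exact lintegral_subtype_comap measurableSet_Ioi
          fun r : ℝ => ENNReal.ofReal (r ^ (Module.finrank ℝ E - 1)) * f (r • (θ : E))

/-- The beta integral as a lower Lebesgue integral. -/
theorem setLIntegral_Ioo_rpow_mul_one_sub_rpow {a b : ℝ} (ha : 0 < a) (hb : 0 < b) :
    ∫⁻ x in Ioo (0 : ℝ) 1, ENNReal.ofReal (x ^ (a - 1) * (1 - x) ^ (b - 1)) =
      ENNReal.ofReal (ProbabilityTheory.beta a b) := by
  have hB := ProbabilityTheory.beta_pos ha hb
  have h := ProbabilityTheory.lintegral_betaPDF_eq_one ha hb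
  rw [ProbabilityTheory.lintegral_betaPDF] at h
  simp_rw [mul_assoc, ENNReal.ofReal_mul (one_div_pos.2 hB).le] at h
  rw [lintegral_const_mul _ (by fun_prop)] at h
  calc _ = ENNReal.ofReal (ProbabilityTheory.beta a b) *
        (ENNReal.ofReal (1 / ProbabilityTheory.beta a b) *
          ∫⁻ x in Ioo (0 : ℝ) 1, ENNReal.ofReal (x ^ (a - 1) * (1 - x) ^ (b - 1))) := by
        rw [← mul_assoc, ← ENNReal.ofReal_mul hB.le, mul_one_div_cancel hB.ne',
          ENNReal.ofReal_one, one_mul]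
    _ = _ := by rw [h, mul_one]

/-- One half of a chord, parametrized by `c = r ^ 2 / (q + 2 * e * r)`. -/
theorem lintegral_half_chord {γ q : ℝ} (hγ : γ ∈ Ioo (0 : ℝ) 1) (hq : 0 < q) (e : ℝ) :
    ∫⁻ r in Ioi (0 : ℝ),
      ENNReal.ofReal ((max (q + 2 * e * r - r ^ 2) 0) ^ γ * r ^ (1 - 2 * γ)) =
    ∫⁻ c in Ioo (0 : ℝ) 1, ENNReal.ofReal (c ^ (-γ) * (1 - c) ^ γ *
      ((e * c + √(e ^ 2 * c ^ 2 + q * c)) *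
        (e + (2 * e ^ 2 * c + q) / (2 * √(e ^ 2 * c ^ 2 + q * c))))) := by
  set s : ℝ → ℝ := fun c => √(e ^ 2 * c ^ 2 + q * c)
  set ρ : ℝ → ℝ := fun c => e * c + s c
  set S : Set ℝ := {r | 0 < r ∧ 0 < q + 2 * e * r - r ^ 2}
  have hS : MeasurableSet S := by
    refine MeasurableSet.inter measurableSet_Ioi ?_
    exact measurableSet_lt (f := fun _ => (0 : ℝ)) measurable_const (by fun_prop)
  have hpos : ∀ c : ℝ, 0 < c → 0 < e ^ 2 * c ^ 2 + q * c := fun c hc => by positivity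
  have hs : ∀ c : ℝ, 0 < c → 0 < s c := fun c hc => Real.sqrt_pos.2 (hpos c hc)
  have hs2 : ∀ c : ℝ, 0 < c → s c ^ 2 = e ^ 2 * c ^ 2 + q * c := fun c hc =>
    Real.sq_sqrt (hpos c hc).le
  have hρ : ∀ c : ℝ, 0 < c → 0 < ρ c := fun c hc => by
    have : |e * c| < s c := by
      apply Real.lt_sqrt_of_sq_lt
      rw [sq_abs]
      nlinarith [mul_pos hq hc]
    have := (abs_lt.1 this).1
    simp only [ρ]; linarith
  have hρ2 : ∀ c : ℝ, 0 < c → ρ c ^ 2 = c * (q + 2 * e * ρ c) := fun c hc => by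
    have := hs2 c hc
    simp only [ρ]; linear_combination this
  have hden : ∀ c : ℝ, 0 < c → 0 < q + 2 * e * ρ c := fun c hc => by
    have h := hρ2 c hc
    have h2 : 0 < ρ c ^ 2 := by have := hρ c hc; positivity
    rw [h] at h2
    exact (mul_pos_iff_of_pos_left hc).1 h2
  have hder : ∀ c : ℝ, 0 < c → HasDerivAt ρ (e + (2 * e ^ 2 * c + q) / (2 * s c)) c := by
    intro c hc
    have h1 : HasDerivAt (fun c : ℝ => e ^ 2 * c ^ 2 + q * c) (2 * e ^ 2 * c + q) c :=
      ((((hasDerivAt_id' c).pow 2).const_mul (e ^ 2)).add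
        ((hasDerivAt_id' c).const_mul q)).congr_deriv (by simp; ring)
    exact (((hasDerivAt_id' c).const_mul e).add (h1.sqrt (hpos c hc).ne')).congr_deriv
      (by rw [mul_one])
  have hder_nonneg : ∀ c : ℝ, 0 < c → 0 ≤ e + (2 * e ^ 2 * c + q) / (2 * s c) := by
    intro c hc
    have h1 := hs c hc
    have h : |e * (2 * s c)| ≤ 2 * e ^ 2 * c + q := by
      apply abs_le_of_sq_le_sq _ (by positivity)
      have := hs2 c hc
      nlinarith [sq_nonneg q]
    have h' := (abs_le.1 h).1
    have : e + (2 * e ^ 2 * c + q) / (2 * s c) =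
        (e * (2 * s c) + (2 * e ^ 2 * c + q)) / (2 * s c) := by
      field_simp
    rw [this]
    apply div_nonneg _ (by positivity)
    linarith
  have hinv : ∀ c : ℝ, 0 < c → ρ c ^ 2 / (q + 2 * e * ρ c) = c := fun c hc => by
    rw [hρ2 c hc, mul_div_cancel_right₀ _ (hden c hc).ne']
  have hinj : InjOn ρ (Ioo 0 1) := fun c hc c' hc' h => by
    rw [← hinv c hc.1, ← hinv c' hc'.1, h]
  have himg : ρ '' Ioo 0 1 = S := by
    ext r
    constructor
    · rintro ⟨c, hc, rfl⟩
      refine ⟨hρ c hc.1, ?_⟩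
      have := hρ2 c hc.1
      nlinarith [hden c hc.1, hc.2]
    · rintro ⟨hr, hr2⟩
      have hD : 0 < q + 2 * e * r := by nlinarith [sq_nonneg r]
      have hc : 0 < r ^ 2 / (q + 2 * e * r) := by positivity
      refine ⟨r ^ 2 / (q + 2 * e * r), ⟨hc, ?_⟩, ?_⟩
      · rw [div_lt_one hD]; linarith
      · have h1 := hρ2 _ hc
        have h2 := hρ _ hc
        set t := ρ (r ^ 2 / (q + 2 * e * r))
        rw [div_mul_eq_mul_div, eq_div_iff hD.ne'] at h1
        have h3 : (t - r) * (q * (t + r) + 2 * e * r * t) = 0 := by linear_combination h1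
        have h4 : 0 < q * (t + r) + 2 * e * r * t := by nlinarith [mul_pos hq hr, mul_pos h2 hD]
        rcases mul_eq_zero.1 h3 with h | h
        · linarith
        · exact absurd h h4.ne'
  have hsub : S ⊆ Ioi 0 := fun r hr => hr.1
  calc ∫⁻ r in Ioi (0 : ℝ),
      ENNReal.ofReal ((max (q + 2 * e * r - r ^ 2) 0) ^ γ * r ^ (1 - 2 * γ))
      = ∫⁻ r in S, ENNReal.ofReal ((max (q + 2 * e * r - r ^ 2) 0) ^ γ * r ^ (1 - 2 * γ)) := by
        rw [← lintegral_indicator measurableSet_Ioi, ← lintegral_indicator hS]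
        refine lintegral_congr fun r => ?_
        by_cases hrS : r ∈ S
        · rw [indicator_of_mem hrS, indicator_of_mem (hsub hrS)]
        rw [indicator_of_notMem hrS]
        refine indicator_apply_eq_zero.2 fun hr => ?_
        have : q + 2 * e * r - r ^ 2 ≤ 0 := by
          by_contra h
          exact hrS ⟨hr, not_le.1 h⟩
        rw [max_eq_right this, Real.zero_rpow hγ.1.ne', zero_mul, ENNReal.ofReal_zero]
    _ = ∫⁻ c in Ioo (0 : ℝ) 1, ENNReal.ofReal |e + (2 * e ^ 2 * c + q) / (2 * s c)| *
          ENNReal.ofReal ((max (q + 2 * e * ρ c - ρ c ^ 2) 0) ^ γ * ρ c ^ (1 - 2 * γ)) := by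
        rw [← himg]
        exact lintegral_image_eq_lintegral_abs_deriv_mul measurableSet_Ioo
          (fun c hc => (hder c hc.1).hasDerivWithinAt) hinj _
    _ = _ := by
        refine setLIntegral_congr_fun measurableSet_Ioo fun c hc => ?_
        have h1 := hρ c hc.1
        have hpow : (ρ c ^ 2) ^ γ = ρ c ^ (2 * γ) := by
          rw [← Real.rpow_natCast, ← Real.rpow_mul h1.le, Nat.cast_ofNat]
        have h2 : 0 < 1 - c := by linarith [hc.2]
        have hc0 := hc.1
        have h3 : q + 2 * e * ρ c - ρ c ^ 2 = ρ c ^ 2 * (c⁻¹ * (1 - c)) := by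
          have := hρ2 c hc.1
          field_simp
          linear_combination (-1 : ℝ) * this
        rw [abs_of_nonneg (hder_nonneg c hc.1), ← ENNReal.ofReal_mul (hder_nonneg c hc.1), h3,
          max_eq_left (by positivity), Real.mul_rpow (by positivity) (by positivity),
          Real.mul_rpow (by positivity) h2.le, Real.inv_rpow hc.1.le, ← Real.rpow_neg hc.1.le,
          hpow, Real.rpow_sub h1, Real.rpow_one]
        have : ρ c ^ (2 * γ) ≠ 0 := by positivity
        change _ = ENNReal.ofReal (c ^ (-γ) * (1 - c) ^ γ *
          (ρ c * (e + (2 * e ^ 2 * c + q) / (2 * s c))))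
        generalize e + (2 * e ^ 2 * c + q) / (2 * s c) = D
        congr 1
        field_simp

/-- The one-dimensional Riesz-type integral along a full chord is an explicit quadratic. -/
theorem lintegral_chord {γ q : ℝ} (hγ : γ ∈ Ioo (0 : ℝ) 1) (hq : 0 < q) (e : ℝ) :
    (∫⁻ r in Ioi (0 : ℝ),
      ENNReal.ofReal ((max (q + 2 * e * r - r ^ 2) 0) ^ γ * r ^ (1 - 2 * γ))) +
    (∫⁻ r in Ioi (0 : ℝ),
      ENNReal.ofReal ((max (q + 2 * (-e) * r - r ^ 2) 0) ^ γ * r ^ (1 - 2 * γ))) =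
    ENNReal.ofReal (4 * e ^ 2 * ProbabilityTheory.beta (2 - γ) (1 + γ) +
      q * ProbabilityTheory.beta (1 - γ) (1 + γ)) := by
  obtain ⟨hγ0, hγ1⟩ := hγ
  have h1 : 0 < 1 - γ := by linarith
  have h2 : 0 < 2 - γ := by linarith
  have h3 : 0 < 1 + γ := by linarith
  have hB1 := (ProbabilityTheory.beta_pos h1 h3).le
  have hB2 := (ProbabilityTheory.beta_pos h2 h3).le
  rw [lintegral_half_chord ⟨hγ0, hγ1⟩ hq, lintegral_half_chord ⟨hγ0, hγ1⟩ hq,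
    ← lintegral_add_left (by fun_prop),
    ENNReal.ofReal_add (by positivity) (by positivity),
    ENNReal.ofReal_mul (by positivity), ENNReal.ofReal_mul hq.le,
    ← setLIntegral_Ioo_rpow_mul_one_sub_rpow h1 h3, ← setLIntegral_Ioo_rpow_mul_one_sub_rpow h2 h3,
    ← lintegral_const_mul _ (by fun_prop), ← lintegral_const_mul _ (by fun_prop),
    ← lintegral_add_left (by fun_prop)]
  refine setLIntegral_congr_fun measurableSet_Ioo fun c hc => ?_
  have hc0 := hc.1
  have hc1 : 0 < 1 - c := by linarith [hc.2]
  have hp : 0 < e ^ 2 * c ^ 2 + q * c := by positivity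
  have hs := Real.sqrt_pos.2 hp
  have hs2 := Real.sq_sqrt hp.le
  have key : ∀ e' : ℝ, e' ^ 2 = e ^ 2 → 0 ≤ (e' * c + √(e ^ 2 * c ^ 2 + q * c)) *
        (e' + (2 * e ^ 2 * c + q) / (2 * √(e ^ 2 * c ^ 2 + q * c))) := by
    intro e' he'
    set s := √(e ^ 2 * c ^ 2 + q * c)
    have a1 : |e' * c| ≤ s := by
      apply abs_le_of_sq_le_sq _ hs.le
      rw [hs2, mul_pow, he']
      nlinarith [mul_pos hq hc0]
    have a2 : |e' * (2 * s)| ≤ 2 * e ^ 2 * c + q := by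
      apply abs_le_of_sq_le_sq _ (by positivity)
      rw [mul_pow, he', mul_pow, hs2]
      nlinarith [sq_nonneg q]
    have a1' := (abs_le.1 a1).1
    have a2' := (abs_le.1 a2).1
    have : e' + (2 * e ^ 2 * c + q) / (2 * s) = (e' * (2 * s) + (2 * e ^ 2 * c + q)) / (2 * s) := by
      field_simp
    rw [this]
    exact mul_nonneg (by linarith) (div_nonneg (by linarith) (by positivity))
  have k1 := key e rfl
  have k2 := key (-e) (neg_sq e)
  simp only [neg_sq]
  rw [← ENNReal.ofReal_add (by positivity) (by positivity), ← ENNReal.ofReal_mul (by positivity),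
    ← ENNReal.ofReal_mul hq.le, ← ENNReal.ofReal_add (by positivity) (by positivity)]
  congr 1
  have e1 : (2 : ℝ) - γ - 1 = -γ + 1 := by ring
  have e2 : (1 : ℝ) - γ - 1 = -γ := by ring
  rw [e1, e2, add_sub_cancel_left, Real.rpow_add hc0, Real.rpow_one]
  set s := √(e ^ 2 * c ^ 2 + q * c)
  have hsn := hs.ne'
  field_simp
  ring

/-- The second moments of the surface measure of the unit sphere. -/
theorem lintegral_toSphere_inner_sq {d : ℕ} [NeZero d] (x : EuclideanSpace ℝ (Fin d)) :
    d * ∫⁻ θ, ENNReal.ofReal (inner ℝ x (θ : EuclideanSpace ℝ (Fin d)) ^ 2)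
      ∂(volume : Measure (EuclideanSpace ℝ (Fin d))).toSphere =
    ENNReal.ofReal (‖x‖ ^ 2) *
      (volume : Measure (EuclideanSpace ℝ (Fin d))).toSphere univ := by
  set σ := (volume : Measure (EuclideanSpace ℝ (Fin d))).toSphere
  let M : EuclideanSpace ℝ (Fin d) → ENNReal := fun x =>
    ∫⁻ θ, ENNReal.ofReal (inner ℝ x (θ : EuclideanSpace ℝ (Fin d)) ^ 2) ∂σ
  let N : EuclideanSpace ℝ (Fin d) → ENNReal := fun x =>
    ∫⁻ z, (Iio (1 : ℝ)).indicator 1 ‖z‖ * ENNReal.ofReal (inner ℝ x z ^ 2)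
  have hd : (0 : ℝ) < d := Nat.cast_pos.2 (NeZero.pos d)
  have hind : Measurable ((Iio (1 : ℝ)).indicator (1 : ℝ → ENNReal)) :=
    measurable_one.indicator measurableSet_Iio
  set κ : ENNReal := ENNReal.ofReal (ProbabilityTheory.beta (d + 2) 1)
  have hβ : 0 < ProbabilityTheory.beta (d + 2) 1 :=
    ProbabilityTheory.beta_pos (by positivity) one_pos
  have hNM : ∀ x, N x = M x * κ := fun x => by
    simp only [N, M]
    rw [lintegral_polar volume (by fun_prop), ← lintegral_mul_const _ (by fun_prop)]
    refine lintegral_congr fun θ => ?_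
    have hκ : κ = ∫⁻ r in Ioi (0 : ℝ),
        (Iio (1 : ℝ)).indicator (fun r => ENNReal.ofReal (r ^ (d + 1))) r := by
      rw [setLIntegral_indicator measurableSet_Iio, Iio_inter_Ioi,
        show κ = _ from (setLIntegral_Ioo_rpow_mul_one_sub_rpow (by positivity) one_pos).symm]
      refine setLIntegral_congr_fun measurableSet_Ioo fun r hr => ?_
      rw [sub_self, Real.rpow_zero, mul_one, ← Real.rpow_natCast]
      congr 2
      push_cast
      ring
    rw [hκ, ← lintegral_const_mul' _ _ ENNReal.ofReal_ne_top]
    refine setLIntegral_congr_fun measurableSet_Ioi fun r hr => ?_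
    have hr : 0 < r := hr
    have hnorm : ‖r • (θ : EuclideanSpace ℝ (Fin d))‖ = r := by
      rw [norm_smul, norm_eq_of_mem_sphere, mul_one, Real.norm_of_nonneg hr.le]
    simp only [hnorm, finrank_euclideanSpace, Fintype.card_fin]
    by_cases h : r ∈ Iio (1 : ℝ)
    · rw [indicator_of_mem h, indicator_of_mem h, Pi.one_apply, one_mul, inner_smul_right,
        ← ENNReal.ofReal_mul (by positivity), ← ENNReal.ofReal_mul (by positivity)]
      congr 1
      obtain ⟨n, rfl⟩ := Nat.exists_eq_succ_of_ne_zero (NeZero.ne d)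
      simp only [Nat.succ_eq_add_one, Nat.add_sub_cancel]
      ring
    · rw [indicator_of_notMem h, indicator_of_notMem h]
      simp
  have hN : ∀ x y : EuclideanSpace ℝ (Fin d), ‖x‖ = ‖y‖ → N x = N y := fun x y hxy => by
    have hT := Submodule.reflection_sub hxy
    set T := (Submodule.span ℝ {x - y})ᗮ.reflection
    simp only [N]
    conv_rhs => rw [← T.measurePreserving.lintegral_comp (by fun_prop)]
    refine lintegral_congr fun z => ?_
    rw [T.norm_map, ← hT, T.inner_map_map]
  have hM : ∀ x y : EuclideanSpace ℝ (Fin d), ‖x‖ = ‖y‖ → M x = M y := fun x y hxy => by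
    have h := hN x y hxy
    rw [hNM, hNM] at h
    exact (ENNReal.mul_left_inj (ENNReal.ofReal_pos.2 hβ).ne' ENNReal.ofReal_ne_top).1 h
  calc d * M x = ∑ i : Fin d, M (‖x‖ • EuclideanSpace.single i (1 : ℝ)) := by
        rw [Finset.sum_congr rfl fun i _ => (hM x (‖x‖ • EuclideanSpace.single i (1 : ℝ))
          (by simp [norm_smul])).symm]
        simp
    _ = ∫⁻ _θ, ENNReal.ofReal (‖x‖ ^ 2) ∂σ := by
        simp only [M]
        rw [← lintegral_finsetSum _ fun i _ => by fun_prop]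
        refine lintegral_congr fun θ => ?_
        rw [← ENNReal.ofReal_sum_of_nonneg fun i _ => sq_nonneg _]
        congr 1
        simp only [inner_smul_left, EuclideanSpace.inner_single_left, mul_pow, ← Finset.mul_sum]
        have := EuclideanSpace.real_norm_sq_eq (θ : EuclideanSpace ℝ (Fin d))
        rw [norm_eq_of_mem_sphere] at this
        simp [← this]
    _ = _ := by rw [lintegral_const]

/-- The Riesz potential of a power of the distance profile of a ball is an explicit quadratic. -/
theorem lintegral_riesz_ball {d : ℕ} [NeZero d] {γ R : ℝ} (hγ : γ ∈ Ioo (0 : ℝ) 1)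
    {x : EuclideanSpace ℝ (Fin d)} (hx : ‖x‖ < R) :
    ∫⁻ z : EuclideanSpace ℝ (Fin d),
      ENNReal.ofReal ((max (R ^ 2 - ‖z‖ ^ 2) 0) ^ γ * ‖x - z‖ ^ (2 - 2 * γ - d)) =
    ENNReal.ofReal ((volume : Measure (EuclideanSpace ℝ (Fin d))).toSphere.real univ / 2 *
      (4 * ProbabilityTheory.beta (2 - γ) (1 + γ) * (‖x‖ ^ 2 / d) +
        (R ^ 2 - ‖x‖ ^ 2) * ProbabilityTheory.beta (1 - γ) (1 + γ))) := by
  set σ := (volume : Measure (EuclideanSpace ℝ (Fin d))).toSphere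
  have hd : (0 : ℝ) < d := Nat.cast_pos.2 (NeZero.pos d)
  have hq : 0 < R ^ 2 - ‖x‖ ^ 2 := by nlinarith [norm_nonneg x]
  have hB1 : 0 < ProbabilityTheory.beta (1 - γ) (1 + γ) :=
    ProbabilityTheory.beta_pos (by linarith [hγ.2]) (by linarith [hγ.1])
  have hB2 : 0 < ProbabilityTheory.beta (2 - γ) (1 + γ) :=
    ProbabilityTheory.beta_pos (by linarith [hγ.2]) (by linarith [hγ.1])
  set B1 := ProbabilityTheory.beta (1 - γ) (1 + γ)
  set B2 := ProbabilityTheory.beta (2 - γ) (1 + γ)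
  set q := R ^ 2 - ‖x‖ ^ 2
  let F : EuclideanSpace ℝ (Fin d) → ENNReal := fun z =>
    ENNReal.ofReal ((max (R ^ 2 - ‖x + z‖ ^ 2) 0) ^ γ * ‖z‖ ^ (2 - 2 * γ - d))
  have hF : Measurable F := by fun_prop
  set I := ∫⁻ z : EuclideanSpace ℝ (Fin d),
      ENNReal.ofReal ((max (R ^ 2 - ‖z‖ ^ 2) 0) ^ γ * ‖x - z‖ ^ (2 - 2 * γ - d))
  have hI : I = ∫⁻ z, F z := by
    simp only [I]
    rw [← lintegral_add_left_eq_self _ x]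
    simp [F]
  have hIneg : I = ∫⁻ z, F (-z) := by
    rw [hI]
    exact ((Measure.measurePreserving_neg volume).lintegral_comp hF).symm
  have hpw : ∀ r ∈ Ioi (0 : ℝ),
      ∀ v : EuclideanSpace ℝ (Fin d), ‖v‖ = 1 →
      ENNReal.ofReal (r ^ (d - 1)) * F (r • v) =
        ENNReal.ofReal ((max (q + 2 * (-inner ℝ x v) * r - r ^ 2) 0) ^ γ * r ^ (1 - 2 * γ)) := by
    intro r hr v hv
    have hr : 0 < r := hr
    have h1 : ‖r • v‖ = r := by rw [norm_smul, hv, mul_one, Real.norm_of_nonneg hr.le]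
    have h2 : R ^ 2 - ‖x + r • v‖ ^ 2 = q + 2 * (-inner ℝ x v) * r - r ^ 2 := by
      rw [norm_add_sq_real, h1, inner_smul_right]
      simp only [q]
      ring
    have h3 : r ^ (1 - 2 * γ) = r ^ (d - 1) * r ^ (2 - 2 * γ - d) := by
      rw [← Real.rpow_natCast, ← Real.rpow_add hr, Nat.cast_pred (NeZero.pos d)]
      congr 1
      ring
    simp only [F]
    rw [h2, h1, ← ENNReal.ofReal_mul (by positivity), h3]
    congr 1
    ring
  have h2I : I + I = ENNReal.ofReal (σ.real univ * (4 * B2 * (‖x‖ ^ 2 / d) + q * B1)) := by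
    calc I + I = ∫⁻ z, (F z + F (-z)) := by
          rw [lintegral_add_left hF, ← hI, ← hIneg]
      _ = ∫⁻ θ, ENNReal.ofReal (4 * B2) *
            ENNReal.ofReal (inner ℝ x (θ : EuclideanSpace ℝ (Fin d)) ^ 2) +
              ENNReal.ofReal (q * B1) ∂σ := by
          have hFF : Measurable fun z => F z + F (-z) := hF.add (hF.comp measurable_neg)
          rw [lintegral_polar volume hFF]
          refine lintegral_congr fun θ => ?_
          have hθ := norm_eq_of_mem_sphere θ
          rw [← ENNReal.ofReal_mul (by positivity), ← ENNReal.ofReal_add (by positivity)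
            (by positivity)]
          have hc := lintegral_chord hγ hq (-inner ℝ x (θ : EuclideanSpace ℝ (Fin d)))
          rw [neg_sq, mul_right_comm] at hc
          rw [← hc, ← lintegral_add_left (by fun_prop)]
          refine setLIntegral_congr_fun measurableSet_Ioi fun r hr => ?_
          simp only [finrank_euclideanSpace, Fintype.card_fin]
          rw [mul_add, hpw r hr θ hθ, ← smul_neg, hpw r hr (-θ) (by rw [norm_neg, hθ]),
            inner_neg_right]
      _ = ENNReal.ofReal (4 * B2) * (ENNReal.ofReal (‖x‖ ^ 2 / d) * σ univ) +
            ENNReal.ofReal (q * B1) * σ univ := by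
          rw [lintegral_add_left (by fun_prop), lintegral_const_mul _ (by fun_prop),
            lintegral_const]
          congr 2
          rw [ENNReal.ofReal_div_of_pos hd, ENNReal.ofReal_natCast, div_eq_mul_inv, mul_right_comm,
            ← lintegral_toSphere_inner_sq, mul_comm, ← mul_assoc,
            ENNReal.inv_mul_cancel (by simpa using NeZero.ne d) (by simp), one_mul]
      _ = _ := by
          rw [← mul_assoc, ← add_mul, ← ENNReal.ofReal_mul (by positivity),
            ← ENNReal.ofReal_add (by positivity) (by positivity), mul_comm (σ.real univ),
            ENNReal.ofReal_mul (by positivity), ofReal_measureReal]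
  rw [div_mul_eq_mul_div, ENNReal.ofReal_div_of_pos two_pos, ← h2I, ← two_mul,
    ENNReal.ofReal_ofNat, mul_comm, ENNReal.mul_div_cancel_right (by simp) (by simp)]

/-- The normalization of the Riesz potential of the Barenblatt pressure. -/
theorem riesz_ball_normalization {d : ℕ} [NeZero d] {γ : ℝ} (hγ : γ ∈ Ioo (0 : ℝ) 1)
    (hγd : 2 - 2 * γ < d) :
    Real.Gamma ((d - (2 - 2 * γ)) / 2) /
      (2 ^ (2 - 2 * γ) * Real.pi ^ ((d : ℝ) / 2) * Real.Gamma ((2 - 2 * γ) / 2)) *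
    (Real.Gamma ((d : ℝ) / 2) /
      (2 ^ (2 * γ) * Real.Gamma (1 + γ) * Real.Gamma ((d + 2 * γ) / 2))) *
    ((volume : Measure (EuclideanSpace ℝ (Fin d))).toSphere.real univ / 2 *
      (4 * ProbabilityTheory.beta (2 - γ) (1 + γ) / d - ProbabilityTheory.beta (1 - γ) (1 + γ))) =
    -1 / (2 * d) := by
  obtain ⟨hγ0, hγ1⟩ := hγ
  have hd : (0 : ℝ) < d := Nat.cast_pos.2 (NeZero.pos d)
  have hσ : (volume : Measure (EuclideanSpace ℝ (Fin d))).toSphere.real univ =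
      d * (Real.pi ^ ((d : ℝ) / 2) / (d / 2 * Real.Gamma ((d : ℝ) / 2))) := by
    rw [Measure.toSphere_real_apply_univ, finrank_euclideanSpace, Fintype.card_fin,
      measureReal_def, EuclideanSpace.volume_ball, ENNReal.ofReal_one, one_pow, one_mul,
      Fintype.card_fin, Real.Gamma_add_one (by positivity), ENNReal.toReal_ofReal (by positivity),
      Real.sqrt_eq_rpow, ← Real.rpow_mul_natCast Real.pi_pos.le]
    congr 3
    ring
  have hG1 : Real.Gamma ((d + 2 * γ) / 2) =
      (d - (2 - 2 * γ)) / 2 * Real.Gamma ((d - (2 - 2 * γ)) / 2) := by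
    rw [← Real.Gamma_add_one (by linarith)]
    congr 1
    ring
  have hB2 : ProbabilityTheory.beta (2 - γ) (1 + γ) =
      (1 - γ) * Real.Gamma (1 - γ) * Real.Gamma (1 + γ) / 2 := by
    rw [ProbabilityTheory.beta, ← Real.Gamma_add_one (by linarith),
      show (2 - γ + (1 + γ)) = 2 + 1 by ring, Real.Gamma_add_one two_ne_zero, Real.Gamma_two,
      mul_one]
    congr 3
    ring
  have hB1 : ProbabilityTheory.beta (1 - γ) (1 + γ) = Real.Gamma (1 - γ) * Real.Gamma (1 + γ) := by
    rw [ProbabilityTheory.beta, show (1 - γ + (1 + γ)) = 2 by ring, Real.Gamma_two, div_one]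
  have h2 : (2 : ℝ) ^ (2 - 2 * γ) = 4 / 2 ^ (2 * γ) := by
    rw [Real.rpow_sub two_pos]
    norm_num
  rw [hσ, hG1, hB2, hB1, h2, show (2 - 2 * γ) / 2 = 1 - γ by ring]
  have p1 := (Real.Gamma_pos_of_pos (s := (d - (2 - 2 * γ)) / 2) (by linarith)).ne'
  have p2 := (Real.Gamma_pos_of_pos (s := 1 - γ) (by linarith)).ne'
  have p3 := (Real.Gamma_pos_of_pos (s := 1 + γ) (by linarith)).ne'
  have p4 := (Real.Gamma_pos_of_pos (s := (d : ℝ) / 2) (by linarith)).ne'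
  have p5 : (2 : ℝ) ^ (2 * γ) ≠ 0 := by positivity
  have p6 : Real.pi ^ ((d : ℝ) / 2) ≠ 0 := by positivity
  have p7 : (d - (2 - 2 * γ)) ≠ 0 := by linarith
  generalize Real.Gamma ((d - (2 - 2 * γ)) / 2) = g1 at *
  generalize Real.Gamma (1 - γ) = g2 at *
  generalize Real.Gamma (1 + γ) = g3 at *
  generalize Real.Gamma ((d : ℝ) / 2) = g4 at *
  generalize (2 : ℝ) ^ (2 * γ) = g5 at *
  generalize Real.pi ^ ((d : ℝ) / 2) = g6 at *
  obtain ⟨D, hD⟩ : ∃ D, D = (d : ℝ) - (2 - 2 * γ) := ⟨_, rfl⟩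
  rw [← hD] at p7 ⊢
  field_simp
  linear_combination 4 * hD

/-- Potentials of integrable functions with bounded support are differentiable away from it. -/
theorem differentiableAt_integral_mul_norm_sub_rpow {E : Type*} [NormedAddCommGroup E]
    [InnerProductSpace ℝ E] [FiniteDimensional ℝ E] [MeasurableSpace E] [BorelSpace E]
    {μ : Measure E} {u : E → ℝ} {R p : ℝ} {y : E} (hu : Integrable u μ)
    (hsupp : ∀ z, R < ‖z‖ → u z = 0) (hp : p ≤ 0) (hy : R < ‖y‖) :
    DifferentiableAt ℝ (fun x => ∫ z, u z * ‖x - z‖ ^ p ∂μ) y := by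
  set ε := (‖y‖ - R) / 2
  have hε : 0 < ε := by simp only [ε]; linarith
  have hfar : ∀ x ∈ ball y ε, ∀ z, ‖z‖ ≤ R → ε ≤ ‖x - z‖ := fun x hx z hz => by
    have h1 : ‖y‖ ≤ ‖x - z‖ + ‖z‖ + ‖y - x‖ := by
      calc ‖y‖ = ‖(x - z) + z + (y - x)‖ := by congr 1; abel
        _ ≤ _ := norm_add₃_le
    have h2 : ‖y - x‖ < ε := by rwa [mem_ball', dist_eq_norm] at hx
    simp only [ε] at h2 ⊢
    linarith
  have hmeas : ∀ x : E, ∀ s : ℝ, Measurable fun z => ‖x - z‖ ^ s := fun x s => by fun_prop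
  have hpow : ∀ x ∈ ball y ε, ∀ z, ‖z‖ ≤ R → ∀ s ≤ (0 : ℝ), ‖x - z‖ ^ s ≤ ε ^ s :=
    fun x hx z hz s hs => Real.rpow_le_rpow_of_nonpos hε (hfar x hx z hz) hs
  refine (hasFDerivAt_integral_of_dominated_of_fderiv_le (ball_mem_nhds y hε)
    (F' := fun x z => u z • ((p * ‖x - z‖ ^ (p - 1)) • fderiv ℝ (fun w : E => ‖w‖) (x - z)))
    (bound := fun z => |u z| * (|p| * ε ^ (p - 1))) ?_ ?_ ?_ ?_ ?_ ?_).differentiableAt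
  · exact .of_forall fun x => hu.1.mul (hmeas x p).aestronglyMeasurable
  · refine (hu.norm.mul_const (ε ^ p)).mono' (hu.1.mul (hmeas y p).aestronglyMeasurable)
      (.of_forall fun z => ?_)
    rw [norm_mul, Real.norm_of_nonneg (by positivity : 0 ≤ ‖y - z‖ ^ p)]
    rcases le_or_gt ‖z‖ R with hz | hz
    · exact mul_le_mul_of_nonneg_left (hpow y (mem_ball_self hε) z hz p hp) (norm_nonneg _)
    · simp [hsupp z hz]
  · exact hu.1.fun_smul (((hmeas y (p - 1)).const_mul p).smul
      ((measurable_fderiv ℝ fun w : E => ‖w‖).comp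
        (measurable_const.sub measurable_id))).aestronglyMeasurable
  · refine .of_forall fun z x hx => ?_
    rw [norm_smul, norm_smul, norm_mul, Real.norm_eq_abs, Real.norm_eq_abs,
      Real.norm_of_nonneg (by positivity : 0 ≤ ‖x - z‖ ^ (p - 1))]
    rcases le_or_gt ‖z‖ R with hz | hz
    · have h1 : ‖fderiv ℝ (fun w : E => ‖w‖) (x - z)‖ ≤ 1 := by
        simpa using norm_fderiv_le_of_lipschitz ℝ (x₀ := x - z) (lipschitzWith_one_norm (E := E))
      have h2 := hpow x hx z hz (p - 1) (by linarith)
      calc |u z| * (|p| * ‖x - z‖ ^ (p - 1) * ‖fderiv ℝ (fun w : E => ‖w‖) (x - z)‖)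
          ≤ |u z| * (|p| * ε ^ (p - 1) * 1) := by gcongr
        _ = _ := by rw [mul_one]
    · simp [hsupp z hz]
  · exact hu.abs.mul_const _
  · refine .of_forall fun z x hx => ?_
    rcases le_or_gt ‖z‖ R with hz | hz
    · have hne : x - z ≠ 0 := norm_pos_iff.1 (hε.trans_le (hfar x hx z hz))
      have h1 : HasFDerivAt (fun w : E => ‖w‖) (fderiv ℝ (fun w : E => ‖w‖) (x - z)) (x - z) :=
        ((contDiffAt_norm ℝ hne).differentiableAt (n := 1) one_ne_zero).hasFDerivAt
      have h2 := h1.comp x ((hasFDerivAt_id x).sub_const z)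
      rw [ContinuousLinearMap.comp_id] at h2
      exact (h2.rpow_const (.inl (norm_ne_zero_iff.2 hne))).const_mul (u z)
    · simp only [hsupp z hz, zero_mul, zero_smul]
      exact hasFDerivAt_const _ _

/-- Inside the ball, the Riesz potential of the Barenblatt pressure is a quadratic. -/
theorem rieszPotential_ball {d : ℕ} [NeZero d] {γ R : ℝ} (hγ : γ ∈ Ioo (0 : ℝ) 1)
    (hγd : 2 - 2 * γ < d) {lam k : ℝ}
    (hk : k = d * lam * (Real.Gamma ((d : ℝ) / 2) /
      (2 ^ (2 * γ) * Real.Gamma (1 + γ) * Real.Gamma ((d + 2 * γ) / 2)))) :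
    ∃ C : ℝ, ∀ x : EuclideanSpace ℝ (Fin d), ‖x‖ < R →
      rieszPotential d (2 - 2 * γ) (fun z => k * (max (R ^ 2 - ‖z‖ ^ 2) 0) ^ γ) x =
        C - lam / 2 * ‖x‖ ^ 2 := by
  have hd : (0 : ℝ) < d := Nat.cast_pos.2 (NeZero.pos d)
  have hB1 : 0 < ProbabilityTheory.beta (1 - γ) (1 + γ) :=
    ProbabilityTheory.beta_pos (by linarith [hγ.2]) (by linarith [hγ.1])
  have hB2 : 0 < ProbabilityTheory.beta (2 - γ) (1 + γ) :=
    ProbabilityTheory.beta_pos (by linarith [hγ.2]) (by linarith [hγ.1])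
  have hN := riesz_ball_normalization hγ hγd
  set c := Real.Gamma ((d - (2 - 2 * γ)) / 2) /
      (2 ^ (2 - 2 * γ) * Real.pi ^ ((d : ℝ) / 2) * Real.Gamma ((2 - 2 * γ) / 2)) with hc
  set K := Real.Gamma ((d : ℝ) / 2) /
      (2 ^ (2 * γ) * Real.Gamma (1 + γ) * Real.Gamma ((d + 2 * γ) / 2))
  set σ := (volume : Measure (EuclideanSpace ℝ (Fin d))).toSphere.real univ
  set B1 := ProbabilityTheory.beta (1 - γ) (1 + γ)
  set B2 := ProbabilityTheory.beta (2 - γ) (1 + γ)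
  refine ⟨c * (k * (σ / 2 * (R ^ 2 * B1))), fun x hx => ?_⟩
  have hq : 0 < R ^ 2 - ‖x‖ ^ 2 := by nlinarith [norm_nonneg x]
  have hint : ∫ z : EuclideanSpace ℝ (Fin d),
      (max (R ^ 2 - ‖z‖ ^ 2) 0) ^ γ * ‖x - z‖ ^ (2 - 2 * γ - d) =
        σ / 2 * (4 * B2 * (‖x‖ ^ 2 / d) + (R ^ 2 - ‖x‖ ^ 2) * B1) := by
    rw [integral_eq_lintegral_of_nonneg_ae (.of_forall fun z => by positivity)
      (Measurable.aestronglyMeasurable (by fun_prop)), lintegral_riesz_ball hγ hx,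
      ENNReal.toReal_ofReal (by positivity)]
  simp only [rieszPotential, mul_assoc k]
  rw [integral_const_mul, hint, ← hc, hk]
  have hd' := hd.ne'
  rw [eq_div_iff (by positivity)] at hN
  field_simp at hN ⊢
  linear_combination (‖x‖ ^ 2 * lam) * hN

theorem barenblatt_profile_equation
    (d : ℕ) (hd : 1 ≤ d) (α m R : ℝ) (hα : α ∈ Set.Ioo (0 : ℝ) 2)
    (hαd : 2 - α < d) (hm : 1 < m) (hR : 0 < R)
    (lam K k : ℝ)
    (hlam : lam = 1 / ((d : ℝ) * (m - 1) + α))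
    (hK : K = Real.Gamma ((d : ℝ) / 2) /
        (2 ^ α * Real.Gamma (1 + α / 2) * Real.Gamma (((d : ℝ) + α) / 2)))
    (hk : k = (d : ℝ) * lam * K)
    (Φ : EuclideanSpace ℝ (Fin d) → ℝ)
    (hΦ : Φ = fun y => (k * (max (R ^ 2 - ‖y‖ ^ 2) 0) ^ (α / 2)) ^ (1 / (m - 1))) :
    ∃ g : EuclideanSpace ℝ (Fin d) → EuclideanSpace ℝ (Fin d),
      -- pointwise identity away from the interface `‖y‖ = R`
      (∀ y : EuclideanSpace ℝ (Fin d), ‖y‖ ≠ R →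
        HasGradientAt (rieszPotential d (2 - α) (fun z => Φ z ^ (m - 1))) (g y) y ∧
        Φ y • g y = (-(lam * Φ y)) • y) ∧
      -- profile equation `-λ ∇·(y Φ) = ∇·(Φ ∇ I_{2-α}(Φ^{m-1}))` in the sense of
      -- distributions on `ℝ^d`
      (∀ φ : EuclideanSpace ℝ (Fin d) → ℝ, ContDiff ℝ (⊤ : ℕ∞) φ → HasCompactSupport φ →
        lam * ∫ y, Φ y * fderiv ℝ φ y y
          = - ∫ y, Φ y * fderiv ℝ φ y (g y)) := by
  have : NeZero d := ⟨by omega⟩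
  have hd0 : (0 : ℝ) < d := Nat.cast_pos.2 (NeZero.pos d)
  obtain ⟨γ, rfl⟩ : ∃ γ, α = 2 * γ := ⟨α / 2, by ring⟩
  rw [mul_div_cancel_left₀ γ two_ne_zero] at hK hΦ
  obtain ⟨hα0, hα2⟩ := hα
  have hγ : γ ∈ Ioo (0 : ℝ) 1 := ⟨by linarith, by linarith⟩
  have hm1 : 0 < m - 1 := by linarith
  have hk0 : 0 ≤ k := by
    have hl : 0 ≤ lam := by rw [hlam]; positivity
    have h1 := (Real.Gamma_pos_of_pos (s := (d : ℝ) / 2) (by positivity)).le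
    have h2 := (Real.Gamma_pos_of_pos (s := 1 + γ) (by linarith [hγ.1])).le
    have h3 := (Real.Gamma_pos_of_pos (s := (d + 2 * γ) / 2) (by linarith [hγ.1])).le
    rw [hk, hK]
    positivity
  have hu : (fun z => Φ z ^ (m - 1)) = fun z => k * (max (R ^ 2 - ‖z‖ ^ 2) 0) ^ γ := by
    funext z
    rw [hΦ, ← Real.rpow_mul (by positivity), one_div_mul_cancel hm1.ne', Real.rpow_one]
  have hpress : ∀ z : EuclideanSpace ℝ (Fin d), R ≤ ‖z‖ →
      k * (max (R ^ 2 - ‖z‖ ^ 2) 0) ^ γ = 0 := fun z hz => by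
    rw [max_eq_right (by nlinarith), Real.zero_rpow hγ.1.ne', mul_zero]
  have hΦ0 : ∀ z : EuclideanSpace ℝ (Fin d), R ≤ ‖z‖ → Φ z = 0 := fun z hz => by
    rw [hΦ]
    simp only [hpress z hz]
    exact Real.zero_rpow (one_div_pos.2 hm1).ne'
  set V := rieszPotential d (2 - 2 * γ) (fun z => Φ z ^ (m - 1)) with hV
  rw [hu] at hV
  have hin : ∀ y : EuclideanSpace ℝ (Fin d), ‖y‖ < R → HasGradientAt V (-lam • y) y := by
    intro y hy
    obtain ⟨C, hC⟩ := rieszPotential_ball (R := R) hγ hαd (hK ▸ hk)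
    have hev : V =ᶠ[nhds y] fun x => C - lam / 2 * ‖x‖ ^ 2 := by
      filter_upwards [(isOpen_lt continuous_norm continuous_const).mem_nhds hy] with x hx
      rw [hV, hC x hx]
    refine HasFDerivAt.congr_of_eventuallyEq ?_ hev
    refine ((((hasStrictFDerivAt_norm_sq y).hasFDerivAt).const_mul (lam / 2)).const_sub
      C).congr_fderiv ?_
    ext w
    simp
    ring
  have hout : ∀ y : EuclideanSpace ℝ (Fin d), R < ‖y‖ → DifferentiableAt ℝ V y := by
    intro y hy
    have hcont : Continuous fun z : EuclideanSpace ℝ (Fin d) =>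
        k * (max (R ^ 2 - ‖z‖ ^ 2) 0) ^ γ :=
      continuous_const.mul (Continuous.rpow_const (by fun_prop) fun _ => .inr hγ.1.le)
    have hcs : HasCompactSupport fun z : EuclideanSpace ℝ (Fin d) =>
        k * (max (R ^ 2 - ‖z‖ ^ 2) 0) ^ γ :=
      HasCompactSupport.intro (isCompact_closedBall 0 R) fun z hz =>
        hpress z (by simpa using (not_le.1 (mt mem_closedBall_zero_iff.2 hz)).le)
    rw [hV]
    exact (differentiableAt_integral_mul_norm_sub_rpow (hcont.integrable_of_hasCompactSupport hcs)
      (fun z hz => hpress z hz.le) (by linarith) hy).const_mul _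
  have hΦg : ∀ y, Φ y • gradient V y = (-(lam * Φ y)) • y := by
    intro y
    rcases lt_or_ge ‖y‖ R with hy | hy
    · rw [(hin y hy).gradient, smul_smul]
      congr 1
      ring
    · simp [hΦ0 y hy]
  refine ⟨gradient V, fun y hy => ⟨?_, hΦg y⟩, fun φ _ _ => ?_⟩
  · rcases lt_or_gt_of_ne hy with h | h
    · exact (hin y h).differentiableAt.hasGradientAt
    · exact (hout y h).hasGradientAt
  · rw [← integral_const_mul, ← integral_neg]
    refine integral_congr_ae (.of_forall fun y => ?_)
    have h := congrArg (fderiv ℝ φ y) (hΦg y)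
    simp only [map_smul, smul_eq_mul] at h
    simp only [h]
    ring
end

section
/- Let d ≥ 1 be an integer, α ∈ (0,2), m > 1, R > 0 and k > 0. The Barenblatt profile Φ(y) = (k(R²−|y|²)_+^{α/2})^{1/(m−1)} is globally Hölder continuous on ℝ^d with exponent θ = min{α/(2(m−1)), 1}: there exists a constant C > 0 such that |Φ(y) − Φ(y′)| ≤ C |y − y′|^{θ} for all y, y′ ∈ ℝ^d. -/
open Real

/-- On a bounded interval `[0, M]` the power function of exponent `β > 0` is Hölder continuous
with exponent `min β 1`. -/
lemma exists_abs_rpow_sub_rpow_le {β M : ℝ} (hβ : 0 < β) (hM : 0 < M) :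
    ∃ C > (0 : ℝ), ∀ a ∈ Set.Icc 0 M, ∀ b ∈ Set.Icc 0 M,
      |a ^ β - b ^ β| ≤ C * |a - b| ^ min β 1 := by
  rcases le_total β 1 with h | h
  · refine ⟨1, one_pos, fun a ha b hb => ?_⟩
    rw [min_eq_left h, one_mul]
    have subadd : ∀ x y : ℝ, 0 ≤ x → 0 ≤ y → x ^ β - y ^ β ≤ |x - y| ^ β := by
      intro x y hx hy
      have h1 : x ^ β ≤ (|x - y| + y) ^ β :=
        rpow_le_rpow hx (by linarith [le_abs_self (x - y)]) hβ.le
      have h2 := rpow_add_le_add_rpow (abs_nonneg (x - y)) hy hβ.le h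
      linarith
    refine abs_sub_le_iff.2 ⟨subadd a b ha.1 hb.1, ?_⟩
    rw [abs_sub_comm]
    exact subadd b a hb.1 ha.1
  · refine ⟨β * M ^ (β - 1), by positivity, fun a ha b hb => ?_⟩
    rw [min_eq_right h, rpow_one]
    refine (convex_Icc 0 M).norm_image_sub_le_of_norm_hasDerivWithin_le
      (f := fun x : ℝ => x ^ β) (f' := fun x => β * x ^ (β - 1))
      (fun x _ => (hasDerivAt_rpow_const (Or.inr h)).hasDerivWithinAt) (fun x hx => ?_) hb ha
    have hx0 : 0 ≤ x := hx.1
    rw [norm_of_nonneg (by positivity)]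
    exact mul_le_mul_of_nonneg_left (rpow_le_rpow hx0 hx.2 (by linarith)) hβ.le

/-- The truncated paraboloid `(R² - ‖y‖²)₊` is Lipschitz with constant `2R`. -/
lemma abs_max_sq_sub_norm_sq_sub_le {E : Type*} [SeminormedAddCommGroup E] {R : ℝ} (hR : 0 ≤ R)
    (y y' : E) :
    |max (R ^ 2 - ‖y‖ ^ 2) 0 - max (R ^ 2 - ‖y'‖ ^ 2) 0| ≤ 2 * R * ‖y - y'‖ := by
  have truncate : ∀ z : E, max (R ^ 2 - ‖z‖ ^ 2) 0 = R ^ 2 - min ‖z‖ R ^ 2 := by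
    intro z
    have hz := norm_nonneg z
    rcases le_total ‖z‖ R with h | h
    · rw [min_eq_left h, max_eq_left (by nlinarith)]
    · rw [min_eq_right h, max_eq_right (by nlinarith), sub_self]
  have hmin : |min ‖y'‖ R - min ‖y‖ R| ≤ ‖y - y'‖ := by
    have h1 := abs_min_sub_min_le_max ‖y'‖ R ‖y‖ R
    rw [sub_self, abs_zero, max_eq_left (abs_nonneg _), abs_sub_comm ‖y'‖] at h1
    exact h1.trans (abs_norm_sub_norm_le y y')
  have h0 : 0 ≤ min ‖y'‖ R + min ‖y‖ R :=
    add_nonneg (le_min (norm_nonneg _) hR) (le_min (norm_nonneg _) hR)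
  rw [truncate, truncate, show R ^ 2 - min ‖y‖ R ^ 2 - (R ^ 2 - min ‖y'‖ R ^ 2)
    = (min ‖y'‖ R + min ‖y‖ R) * (min ‖y'‖ R - min ‖y‖ R) by ring, abs_mul, abs_of_nonneg h0]
  refine mul_le_mul ?_ hmin (abs_nonneg _) (by positivity)
  linarith [min_le_right ‖y'‖ R, min_le_right ‖y‖ R]

theorem barenblatt_profile_holder_continuous
    (d : ℕ) (hd : 1 ≤ d) (α m R k : ℝ) (hα : α ∈ Set.Ioo (0 : ℝ) 2)
    (hm : 1 < m) (hR : 0 < R) (hk : 0 < k)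
    (Φ : EuclideanSpace ℝ (Fin d) → ℝ)
    (hΦ : Φ = fun y => (k * (max (R ^ 2 - ‖y‖ ^ 2) 0) ^ (α / 2)) ^ (1 / (m - 1)))
    (θ : ℝ) (hθ : θ = min (α / (2 * (m - 1))) 1) :
    ∃ C > (0 : ℝ), ∀ y y' : EuclideanSpace ℝ (Fin d),
      |Φ y - Φ y'| ≤ C * ‖y - y'‖ ^ θ := by
  have hm' : 0 < m - 1 := sub_pos.2 hm
  have hβ : 0 < α / (2 * (m - 1)) := div_pos hα.1 (by positivity)
  have hθ0 : 0 ≤ θ := hθ ▸ le_min hβ.le zero_le_one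
  obtain ⟨C, hC, hpow⟩ := exists_abs_rpow_sub_rpow_le hβ (pow_pos hR 2)
  rw [← hθ] at hpow
  set w : EuclideanSpace ℝ (Fin d) → ℝ := fun y => max (R ^ 2 - ‖y‖ ^ 2) 0
  have hw_mem : ∀ y, w y ∈ Set.Icc 0 (R ^ 2) := fun y =>
    ⟨le_max_right _ _, max_le (by linarith [sq_nonneg ‖y‖]) (sq_nonneg R)⟩
  have hΦw : ∀ y, Φ y = k ^ (1 / (m - 1)) * w y ^ (α / (2 * (m - 1))) := by
    intro y
    have h0 : 0 ≤ w y := (hw_mem y).1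
    have hexp : α / 2 * (1 / (m - 1)) = α / (2 * (m - 1)) := by field_simp
    simp only [hΦ]
    rw [mul_rpow hk.le (by positivity), ← rpow_mul (by positivity), hexp]
  refine ⟨k ^ (1 / (m - 1)) * (C * (2 * R) ^ θ), by positivity, fun y y' => ?_⟩
  rw [hΦw, hΦw, ← mul_sub, abs_mul, abs_of_pos (by positivity), mul_assoc, mul_assoc,
    ← mul_rpow (by positivity) (norm_nonneg _)]
  gcongr
  refine (hpow _ (hw_mem y) _ (hw_mem y')).trans ?_
  gcongr
  exact abs_max_sq_sub_norm_sq_sub_le hR.le y y'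
end
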